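/- arXiv:1911.10883 — 3 statements merged into one kernel-verified Lean document; each statement's English description precedes it below -/
import Mathlib

section
/- A binary path P is the filling of some binary path if and only if P ≠ d and P satisfies all of the following: (i) P avoids d²u² as a factor; (ii) P does not start with du²; (iii) P does not end with d². -/
/-- A binary path is a list of steps: `true` = upstep `u`, `false` = downstep `d`. -/
abbrev BinPath := List Bool

/-- `ht P k` is the height of the `k`-th point of the path `P` (the point reached
after the first `k` steps). -/
def ht (P : BinPath) (k : ℕ) : ℤ :=
  ((P.take k).map (fun b => if b then (1 : ℤ) else -1)).sum

/-- The lattice order on binary paths of the same length: `P ≤ Q` iff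
`hᵢ(P) ≤ hᵢ(Q)` for all `i`. -/
def pathLe (P Q : BinPath) : Prop :=
  P.length = Q.length ∧ ∀ k, ht P k ≤ ht Q k

def pathLt (P Q : BinPath) : Prop := pathLe P Q ∧ P ≠ Q

/-- The maximum path `1ₙ = uⁿ`. -/
def maxPath (n : ℕ) : BinPath := List.replicate n true

/-- Step `i` (0-based) of `P` is a downstep whose endpoint is a valley, i.e. it is
followed by an upstep or it is the last step of `P`. -/
def isValley (P : BinPath) (i : ℕ) : Prop :=
  i < P.length ∧ P.getD i true = false ∧ P.getD (i + 1) true = true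

/-- The number of valleys of `P`. -/
def numValleys (P : BinPath) : ℕ :=
  ((Finset.range P.length).filter
    (fun i => P.getD i true = false ∧ P.getD (i + 1) true = true)).card

/-- The filling of `P`: every valley of `P` is turned into a peak
(each occurrence `du` whose middle point is a valley becomes `ud`, and a final
valley-`d` becomes `u`). -/
def fill (P : BinPath) : BinPath :=
  List.ofFn (fun i : Fin P.length =>
    if P.get i then P.getD (i.1 - 1) true else P.getD (i.1 + 1) true)

/-- The degree of `P`: the least `k` such that the `k`-fold iterated filling
of `P` is the maximum path. -/
noncomputable def degree (P : BinPath) : ℕ :=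
  sInf {k | fill^[k] P = maxPath P.length}

/-- `fPath P` is the number of chains from `P` to the maximum path `1_{|P|}` of
length `degree P` having small intervals. -/
noncomputable def fPath (P : BinPath) : ℕ :=
  Set.ncard {c : ℕ → BinPath |
    c 0 = P ∧ (∀ i, degree P ≤ i → c i = maxPath P.length) ∧
    ∀ i < degree P, pathLt (c i) (c (i + 1)) ∧ pathLe (c (i + 1)) (fill (c i))}

/-- Height of the lowest valley of `P`. -/
noncomputable def lv (P : BinPath) : ℤ :=
  sInf {h : ℤ | ∃ i, isValley P i ∧ ht P (i + 1) = h}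

/-- Height of the highest valley of `P`. -/
noncomputable def hv (P : BinPath) : ℤ :=
  sSup {h : ℤ | ∃ i, isValley P i ∧ ht P (i + 1) = h}

noncomputable def hvNat (P : BinPath) : ℕ := (hv P).toNat

/-- `P′`: every low valley of `P` is turned into a peak. -/
noncomputable def lowFill (P : BinPath) : BinPath :=
  List.ofFn (fun i : Fin P.length =>
    if P.get i then
      (if P.getD (i.1 - 1) true = false ∧ ht P i.1 = lv P then false else true)
    else
      (if P.getD (i.1 + 1) true = true ∧ ht P (i.1 + 1) = lv P then true else false))

/-- `P*`: every valley of `P` is turned into a peak, except the last one when `P`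
ends with a downstep. -/
def starFill (P : BinPath) : BinPath :=
  List.ofFn (fun i : Fin P.length =>
    if i.1 + 1 = P.length ∧ P.get i = false then false
    else if P.get i then P.getD (i.1 - 1) true else P.getD (i.1 + 1) true)

/-- A Dyck path: starts and ends at height 0 and lies weakly above height 0. -/
def IsDyck (P : BinPath) : Prop := ht P P.length = 0 ∧ ∀ k, 0 ≤ ht P k

/-- A Dyck prefix: a prefix of a Dyck path. -/
def IsDyckPrefix (P : BinPath) : Prop := ∃ Q : BinPath, IsDyck (P ++ Q)

/-- A Dyck suffix: a suffix of a Dyck path. -/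
def IsDyckSuffix (P : BinPath) : Prop := ∃ Q : BinPath, IsDyck (Q ++ P)

/-- The pyramid `u^m d^m`. -/
def pyramid (m : ℕ) : BinPath := List.replicate m true ++ List.replicate m false

/-- Cardinality of the interval `[P, Q]` in the lattice of binary paths. -/
noncomputable def intervalCard (P Q : BinPath) : ℕ :=
  Set.ncard {R : BinPath | pathLe P R ∧ pathLe R Q}

/-- `I(s) = |[s, u^{|s|/2} d^{|s|/2}]|`. -/
noncomputable def Ifun (s : BinPath) : ℕ := intervalCard s (pyramid (s.length / 2))

/-- `J(P) = |[P, u^{|P|}]|`. -/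
noncomputable def Jfun (P : BinPath) : ℕ := intervalCard P (maxPath P.length)

/-- `P` and `Q` have exactly the same valleys at every height at most `m`. -/
def sameValleysUpTo (P Q : BinPath) (m : ℤ) : Prop :=
  ∀ (i : ℕ) (t : ℤ), t ≤ m →
    ((isValley P i ∧ ht P (i + 1) = t) ↔ (isValley Q i ∧ ht Q (i + 1) = t))

/-- A multichain of Dyck paths of type `V` from `a` to `s`: it has length
`h = hv(a)` and for every `j ∈ [h]` its `(j-1)`-st and `j`-th members have the
same valleys at every height at most `h - j`.  (The function `σ` is frozen from
index `h` on, so that such multichains are counted correctly.) -/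
def IsVChain (a s : BinPath) (σ : ℕ → BinPath) : Prop :=
  σ 0 = a ∧ (∀ j, hvNat a ≤ j → σ j = s) ∧ (∀ j, IsDyck (σ j)) ∧
  (∀ j < hvNat a, pathLe (σ j) (σ (j + 1))) ∧
  (∀ j, 1 ≤ j → j ≤ hvNat a →
    sameValleysUpTo (σ (j - 1)) (σ j) ((hvNat a : ℤ) - (j : ℤ)))

/-- `V(a,s)`: the number of `a`–`s` multichains of type `V`. -/
noncomputable def VPath (a s : BinPath) : ℕ :=
  Set.ncard {σ : ℕ → BinPath | IsVChain a s σ}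

/-- `ζ^k(P,Q)`: the number of `P`–`Q` multichains of length `k`. -/
noncomputable def zetaPow (k : ℕ) (P Q : BinPath) : ℕ :=
  Set.ncard {c : ℕ → BinPath |
    c 0 = P ∧ (∀ i, k ≤ i → c i = Q) ∧ ∀ i < k, pathLe (c i) (c (i + 1))}

/-- The join of two paths of the same length (pointwise max of heights). -/
def pathSup (P Q : BinPath) : BinPath :=
  List.ofFn (fun i : Fin P.length =>
    decide (max (ht P i.1) (ht Q i.1) < max (ht P (i.1 + 1)) (ht Q (i.1 + 1))))

/-- The meet of two paths of the same length (pointwise min of heights). -/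
def pathInf (P Q : BinPath) : BinPath :=
  List.ofFn (fun i : Fin P.length =>
    decide (min (ht P i.1) (ht Q i.1) < min (ht P (i.1 + 1)) (ht Q (i.1 + 1))))

/-- `Q` covers `P` in the lattice of binary paths. -/
def pathCovBy (P Q : BinPath) : Prop :=
  pathLt P Q ∧ ∀ R : BinPath, pathLt P R → pathLt R Q → False

/-- `l(P,Q) = (1/2)·Σᵢ (hᵢ(Q) − hᵢ(P))`. -/
def lpq (P Q : BinPath) : ℕ :=
  ((∑ i ∈ Finset.range P.length, (ht Q (i + 1) - ht P (i + 1))) / 2).toNat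

/-- Convolution in the incidence algebra of the lattice of binary paths. -/
noncomputable def conv (F G : BinPath → BinPath → ℤ) : BinPath → BinPath → ℤ :=
  fun P Q => ∑ᶠ (R : BinPath) (_ : pathLe P R ∧ pathLe R Q), F P R * G R Q

/-- The delta function of the incidence algebra. -/
def deltaFun : BinPath → BinPath → ℤ := fun P Q => if P = Q then 1 else 0

/-- `μ^k`: the `k`-th convolution power of `μ` (`μ^0` is the delta function). -/
noncomputable def muPow (mu : BinPath → BinPath → ℤ) (k : ℕ) : BinPath → BinPath → ℤ :=
  (conv mu)^[k] deltaFun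

/-- Turning every peak of `P` into a valley. -/
def dig (P : BinPath) : BinPath :=
  List.ofFn (fun i : Fin P.length =>
    if P.get i then P.getD (i.1 + 1) false else i.1 ≠ 0 && P.getD (i.1 - 1) true)

theorem length_fill (P : BinPath) : (fill P).length = P.length := by
  simp [fill]

theorem length_dig (P : BinPath) : (dig P).length = P.length := by
  simp [dig]

theorem getElem_fill (P : BinPath) (i : ℕ) (h : i < (fill P).length) :
    (fill P)[i] = if P.getD i true then P.getD (i - 1) true else P.getD (i + 1) true := by
  have hi : i < P.length := by simpa [length_fill] using h
  simp [fill, hi]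

theorem getElem_dig (P : BinPath) (i : ℕ) (h : i < (dig P).length) :
    (dig P)[i] = if P.getD i true then P.getD (i + 1) false
      else i ≠ 0 && P.getD (i - 1) true := by
  have hi : i < P.length := by simpa [length_dig] using h
  simp [dig, hi]

theorem isInfix_dduu_iff (P : BinPath) :
    [false, false, true, true] <:+: P ↔ ∃ k, ∃ _ : k + 3 < P.length,
      P[k] = false ∧ P[k + 1] = false ∧ P[k + 2] = true ∧ P[k + 3] = true := by
  constructor
  · rintro ⟨s, t, rfl⟩
    exact ⟨s.length, by simp, by simp, by simp, by simp, by simp⟩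
  · rintro ⟨k, hk, h0, h1, h2, h3⟩
    refine ⟨P.take k, P.drop (k + 4), ?_⟩
    conv_rhs => rw [← List.take_append_drop k P, List.drop_eq_getElem_cons (by omega),
      List.drop_eq_getElem_cons (by omega), List.drop_eq_getElem_cons (by omega),
      List.drop_eq_getElem_cons (by omega), h0, h1, h2, h3]
    simp

theorem isPrefix_duu_iff (P : BinPath) :
    [false, true, true] <+: P ↔ ∃ _ : 2 < P.length,
      P[0] = false ∧ P[1] = true ∧ P[2] = true := by
  rcases P with _ | ⟨a, _ | ⟨b, _ | ⟨c, P⟩⟩⟩ <;> simp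

theorem isSuffix_dd_iff (P : BinPath) :
    [false, false] <:+ P ↔ ∃ k, ∃ _ : k + 2 = P.length,
      P[k] = false ∧ P[k + 1] = false := by
  constructor
  · rintro ⟨s, rfl⟩
    exact ⟨s.length, by simp, by simp, by simp⟩
  · rintro ⟨k, hk, h0, h1⟩
    refine ⟨P.take k, List.ext_getElem (by simp; omega) ?_⟩
    intro i _ _
    grind

theorem fill_dig (P : BinPath) (hd : P ≠ [false])
    (h1 : ¬ [false, false, true, true] <:+: P) (h2 : ¬ [false, true, true] <+: P)
    (h3 : ¬ [false, false] <:+ P) : fill (dig P) = P := by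
  rw [isInfix_dduu_iff] at h1
  rw [isPrefix_duu_iff] at h2
  rw [isSuffix_dd_iff] at h3
  push Not at h1 h2 h3
  refine List.ext_getElem (by simp [length_fill, length_dig]) ?_
  intro i hi hi'
  have hd' : P.length = 1 → P[i] = true := by
    intro hl
    obtain ⟨a, rfl⟩ := List.length_eq_one_iff.mp hl
    cases a <;> simp_all
  rw [getElem_fill]
  obtain _ | _ | j := i
  · clear h1 h3 hd
    grind [length_dig, getElem_dig]
  · have h1' := h1 0
    have h3' := h3 0
    clear h1 h3 hd
    grind [length_dig, getElem_dig]
  · have h1' := h1 j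
    have h1'' := h1 (j + 1)
    have h3' := h3 (j + 1)
    clear h1 h2 h3 hd
    grind [length_dig, getElem_dig]

/-- A binary path `P` is the filling of some binary path iff
`P ≠ d` and: (i) `P` avoids `d²u²` as a factor; (ii) `P` does not start with
`du²`; (iii) `P` does not end with `d²`. -/
theorem statement1 (P : BinPath) :
    (∃ Q : BinPath, fill Q = P) ↔
      (P ≠ [false] ∧
        ¬ [false, false, true, true] <:+: P ∧
        ¬ [false, true, true] <+: P ∧
        ¬ [false, false] <:+ P) := by
  constructor
  · rintro ⟨Q, rfl⟩
    rw [isInfix_dduu_iff, isPrefix_duu_iff, isSuffix_dd_iff]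
    refine ⟨?_, ?_, ?_, ?_⟩
    · intro h
      have hl : Q.length = 1 := by rw [← length_fill, h]; rfl
      obtain ⟨a, rfl⟩ := List.length_eq_one_iff.mp hl
      cases a <;> simp [fill] at h
    · rintro ⟨k, hk, h0, h1, h2, h3⟩
      rw [getElem_fill] at h0 h1 h2 h3
      grind
    · rintro ⟨hk, h0, h1, h2⟩
      rw [getElem_fill] at h0 h1 h2
      grind
    · rintro ⟨k, hk, h0, h1⟩
      rw [length_fill] at hk
      rw [getElem_fill] at h0 h1
      grind
  · rintro ⟨hd, h1, h2, h3⟩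
    exact ⟨dig P, fill_dig P hd h1 h2 h3⟩
end

section
/- Let a_n be the number of binary paths of length n that are fillings of some binary path. Then a_0 = a_1 = 1, a_2 = 3, and a_n = a_{n−1} + a_{n−2} + a_{n−3} for all n ≥ 3 (i.e., a_n is the (n+1)-st tribonacci number). -/
/-- The number of binary paths of length `n` that are fillings of some binary path. -/
noncomputable def fillCount (n : ℕ) : ℕ :=
  Set.ncard {P : BinPath | P.length = n ∧ ∃ Q : BinPath, fill Q = P}

/-- The filling of `P` when the step preceding `P` is `l`. -/
def fillAfter : Bool → BinPath → BinPath
  | _, [] => []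
  | l, c :: P => (if c then l else P.headD true) :: fillAfter c P

theorem length_fillAfter (l : Bool) (P : BinPath) : (fillAfter l P).length = P.length := by
  induction P generalizing l with
  | nil => rfl
  | cons c P ih => simp [fillAfter, ih]

theorem getElem_fillAfter (l : Bool) (P : BinPath) (i : ℕ) (h : i < (fillAfter l P).length)
    (h₀ : i < P.length) :
    (fillAfter l P)[i] = if P[i] then (l :: P).getD i true else P.getD (i + 1) true := by
  induction P generalizing l i with
  | nil => simp at h₀
  | cons c P ih =>
    cases i with
    | zero => cases P <;> simp [fillAfter]
    | succ i =>
      have := ih c i (by simpa [fillAfter] using h) (by simpa using h₀)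
      simpa [fillAfter] using this

theorem fill_eq_fillAfter (P : BinPath) : fill P = fillAfter true P := by
  refine List.ext_getElem (by simp [fill, length_fillAfter]) fun i h₁ h₂ => ?_
  have h : i < P.length := by simpa [fill] using h₁
  rw [getElem_fillAfter _ _ _ _ h]
  cases i with
  | zero =>
    simp only [fill, List.getElem_ofFn, List.get_eq_getElem, List.getD_cons_zero, Nat.zero_sub,
      List.getD_eq_getElem _ _ h]
    split_ifs with hP
    exacts [hP, rfl]
  | succ i => simp [fill, List.getElem?_eq_getElem (Nat.lt_of_succ_lt h)]

/-- `w` is the filling of a path preceded by the step `l` and having first step `c`,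
an empty path being regarded as starting with an upstep. -/
def IsFillAfter (l c : Bool) (w : BinPath) : Prop :=
  ∃ Q, fillAfter l Q = w ∧ Q.headD true = c

theorem isFillAfter_nil (l c : Bool) : IsFillAfter l c [] ↔ c = true := by
  constructor
  · rintro ⟨_ | ⟨a, Q⟩, h, rfl⟩
    · rfl
    · simp [fillAfter] at h
  · rintro rfl
    exact ⟨[], rfl, rfl⟩

theorem isFillAfter_cons (l c o : Bool) (w : BinPath) :
    IsFillAfter l c (o :: w) ↔ ∃ r, o = (if c then l else r) ∧ IsFillAfter c r w := by
  constructor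
  · rintro ⟨_ | ⟨a, Q⟩, h, rfl⟩
    · simp [fillAfter] at h
    · simp only [fillAfter, List.cons.injEq] at h
      exact ⟨Q.headD true, h.1.symm, Q, h.2, rfl⟩
  · rintro ⟨r, rfl, Q, rfl, rfl⟩
    exact ⟨c :: Q, rfl, rfl⟩

theorem exists_fill_eq_iff (w : BinPath) :
    (∃ Q, fill Q = w) ↔ ∃ c, IsFillAfter true c w := by
  simp only [IsFillAfter, fill_eq_fillAfter]
  exact ⟨fun ⟨Q, h⟩ => ⟨_, Q, h, rfl⟩, fun ⟨_, Q, h, _⟩ => ⟨Q, h⟩⟩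

/-- The filling of a path starting with a downstep does not depend on the preceding step. -/
theorem isFillAfter_true_false (w : BinPath) :
    IsFillAfter true false w ↔ IsFillAfter false false w := by
  cases w <;> simp [isFillAfter_nil, isFillAfter_cons]

/-- The number of binary paths of length `n` satisfying `p`. -/
noncomputable def pathCount (p : BinPath → Prop) (n : ℕ) : ℕ :=
  Set.ncard {w : BinPath | w.length = n ∧ p w}

theorem finite_length_eq_and (p : BinPath → Prop) (n : ℕ) :
    {w : BinPath | w.length = n ∧ p w}.Finite :=
  (List.finite_length_eq Bool n).subset fun _ h => h.1

theorem pathCount_zero_of {p : BinPath → Prop} (h : p []) : pathCount p 0 = 1 := by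
  rw [pathCount, Set.ncard_eq_one]
  refine ⟨[], Set.ext fun w => ?_⟩
  simp only [Set.mem_ofPred_eq, List.length_eq_zero_iff, Set.mem_singleton_iff]
  exact ⟨And.left, fun hw => ⟨hw, hw ▸ h⟩⟩

theorem pathCount_eq_zero {p : BinPath → Prop} {n : ℕ} (h : ∀ w, w.length = n → ¬ p w) :
    pathCount p n = 0 := by
  rw [pathCount, Set.ncard_eq_zero (finite_length_eq_and p n)]
  exact Set.eq_empty_of_forall_notMem fun w hw => h w hw.1 hw.2

theorem pathCount_congr {p q : BinPath → Prop} (h : ∀ w, p w ↔ q w) (n : ℕ) :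
    pathCount p n = pathCount q n := by
  rw [funext fun w => propext (h w)]

theorem pathCount_succ (p : BinPath → Prop) (n : ℕ) :
    pathCount p (n + 1) =
      pathCount (fun w => p (true :: w)) n + pathCount (fun w => p (false :: w)) n := by
  have key : {w : BinPath | w.length = n + 1 ∧ p w} =
      Set.image (List.cons true) {w | w.length = n ∧ p (true :: w)} ∪
        Set.image (List.cons false) {w | w.length = n ∧ p (false :: w)} := by
    ext w
    rcases w with _ | ⟨_ | _, w⟩ <;> simp
  rw [pathCount, key, Set.ncard_union_eq ?_ ((finite_length_eq_and _ n).image _) ((finite_length_eq_and _ n).image _),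
    Set.ncard_image_of_injective _ List.cons_injective,
    Set.ncard_image_of_injective _ List.cons_injective, pathCount, pathCount]
  rw [Set.disjoint_left]
  rintro _ ⟨w, -, rfl⟩ ⟨v, -, h⟩
  simp at h

/-- `w` is a filling of some path. -/
def IsFilling (w : BinPath) : Prop := ∃ c, IsFillAfter true c w

/-- `w` is a filling, or the filling of a path preceded by a downstep and not starting with
one. -/
def IsFillingAfterUp (w : BinPath) : Prop := IsFilling w ∨ IsFillAfter false true w

theorem fillCount_eq (n : ℕ) : fillCount n = pathCount IsFilling n := by
  simp only [fillCount, exists_fill_eq_iff]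
  rfl

theorem pathCount_isFilling_succ (n : ℕ) : pathCount IsFilling (n + 1) =
    pathCount IsFillingAfterUp n + pathCount (IsFillAfter false false) n := by
  rw [pathCount_succ]
  congr 1 <;> refine pathCount_congr (fun w => ?_) n <;>
    simp [IsFillingAfterUp, IsFilling, isFillAfter_cons, or_comm, or_left_comm]

theorem pathCount_isFillingAfterUp_succ (n : ℕ) : pathCount IsFillingAfterUp (n + 1) =
    pathCount IsFillingAfterUp n + pathCount IsFilling n := by
  rw [pathCount_succ]
  congr 1 <;> refine pathCount_congr (fun w => ?_) n
  · simp [IsFillingAfterUp, IsFilling, isFillAfter_cons, ← isFillAfter_true_false]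
    tauto
  · simp [IsFillingAfterUp, IsFilling, isFillAfter_cons, ← isFillAfter_true_false]

theorem pathCount_isFillAfter_false_false_succ (n : ℕ) :
    pathCount (IsFillAfter false false) (n + 1) =
      pathCount (IsFillAfter false true) n + pathCount (IsFillAfter false false) n := by
  rw [pathCount_succ]
  congr 1 <;> refine pathCount_congr (fun w => ?_) n <;> simp [isFillAfter_cons]

theorem pathCount_isFillAfter_false_true_succ (n : ℕ) :
    pathCount (IsFillAfter false true) (n + 1) = pathCount IsFilling n := by
  rw [pathCount_succ, pathCount_eq_zero fun w _ => by simp [isFillAfter_cons], zero_add]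
  refine pathCount_congr (fun w => ?_) n
  simp [IsFilling, isFillAfter_cons]

/-- The number `aₙ` of fillings of length `n` satisfies
`a₀ = a₁ = 1`, `a₂ = 3` and the tribonacci recurrence
`aₙ = a_{n−1} + a_{n−2} + a_{n−3}` for `n ≥ 3`. -/
theorem statement2 :
    fillCount 0 = 1 ∧ fillCount 1 = 1 ∧ fillCount 2 = 3 ∧
    ∀ n : ℕ, 3 ≤ n →
      fillCount n = fillCount (n - 1) + fillCount (n - 2) + fillCount (n - 3) := by
  simp only [fillCount_eq]
  have a₀ : pathCount IsFilling 0 = 1 :=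
    pathCount_zero_of ⟨true, (isFillAfter_nil _ _).2 rfl⟩
  have b₀ : pathCount IsFillingAfterUp 0 = 1 :=
    pathCount_zero_of (.inr ((isFillAfter_nil _ _).2 rfl))
  have c₀ : pathCount (IsFillAfter false false) 0 = 0 :=
    pathCount_eq_zero fun w hw => by
      rw [List.length_eq_zero_iff.1 hw]
      simp [isFillAfter_nil]
  have d₀ : pathCount (IsFillAfter false true) 0 = 1 :=
    pathCount_zero_of ((isFillAfter_nil _ _).2 rfl)
  have a := pathCount_isFilling_succ
  have b := pathCount_isFillingAfterUp_succ
  have c := pathCount_isFillAfter_false_false_succ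
  have d := pathCount_isFillAfter_false_true_succ
  refine ⟨a₀, by rw [a, b₀, c₀], by rw [a, b, c, a₀, b₀, c₀, d₀], fun n hn => ?_⟩
  obtain ⟨n, rfl⟩ := Nat.exists_eq_add_of_le' hn
  rw [show n + 3 - 1 = n + 2 by lia, show n + 3 - 2 = n + 1 by lia, Nat.add_sub_cancel]
  have h₁ := a (n + 2)
  have h₂ := a (n + 1)
  have h₃ := b (n + 1)
  have h₄ := c (n + 1)
  have h₅ := d n
  lia
end

section
/- For every binary path P ∈ 𝒫_n, the length of every chain from P to 1_n with small intervals is greater than or equal to the degree δ(P). -/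
theorem ht_zero (P : BinPath) : ht P 0 = 0 := by simp [ht]

theorem ht_succ {P : BinPath} {k : ℕ} (h : k < P.length) :
    ht P (k + 1) = ht P k + if P.getD k true then 1 else -1 := by
  rw [ht, ht, ← List.take_concat_get' _ _ h, List.getD_eq_getElem _ _ h, List.map_append,
    List.sum_append]
  simp only [List.map_cons, List.map_nil, List.sum_singleton]

theorem ht_of_length_le {P : BinPath} {k : ℕ} (h : P.length ≤ k) : ht P k = ht P P.length := by
  simp [ht, List.take_of_length_le h]

theorem getD_fill {P : BinPath} {k : ℕ} (h : k < P.length) :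
    (fill P).getD k true =
      if P.getD k true then P.getD (k - 1) true else P.getD (k + 1) true := by
  have h' : k < (fill P).length := by rwa [length_fill]
  rw [List.getD_eq_getElem _ _ h', List.getD_eq_getElem _ _ h]
  simp [fill]

/-- Filling raises exactly the valleys, each by two. -/
theorem ht_fill_succ {P : BinPath} {k : ℕ} (h : k < P.length) :
    ht (fill P) (k + 1) = ht P (k + 1) +
      if P.getD k true = false ∧ P.getD (k + 1) true = true then 2 else 0 := by
  have h' : k < (fill P).length := by rwa [length_fill]
  induction k with
  | zero =>
    rw [ht_succ h', ht_succ h, getD_fill h, ht_zero, ht_zero]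
    cases P.getD 0 true <;> cases P.getD (0 + 1) true <;> simp_all
  | succ k ih =>
    rw [ht_succ h', ht_succ h, getD_fill h, ih (by omega) (by omega), Nat.add_sub_cancel]
    cases P.getD k true <;> cases P.getD (k + 1) true <;>
      cases P.getD (k + 1 + 1) true <;> simp <;> ring

/-- The heights of the filling are a monotone function of the heights of the path. -/
theorem ht_fill_eq_min {P : BinPath} {k : ℕ} (h : k + 1 < P.length) :
    ht (fill P) (k + 1) = min (ht P k) (ht P (k + 2)) + 1 := by
  rw [ht_fill_succ (by omega), ht_succ h, ht_succ (by omega : k < P.length)]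
  cases P.getD k true <;> cases P.getD (k + 1) true <;> simp <;> omega

theorem ht_fill_last {P : BinPath} {k : ℕ} (h : k + 1 = P.length) :
    ht (fill P) (k + 1) = ht P k + 1 := by
  rw [ht_fill_succ (by omega), ht_succ (by omega), List.getD_eq_default (n := k + 1) _ _ h.ge]
  cases P.getD k true <;> simp
  ring

theorem pathLe_of_forall_le_length {P Q : BinPath} (hl : P.length = Q.length)
    (h : ∀ k ≤ P.length, ht P k ≤ ht Q k) : pathLe P Q := by
  refine ⟨hl, fun k => ?_⟩
  rcases le_total k P.length with hk | hk
  · exact h k hk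
  · rw [ht_of_length_le hk, ht_of_length_le (hl.symm.le.trans hk), ← hl]
    exact h _ le_rfl

theorem pathLe_refl (P : BinPath) : pathLe P P := ⟨rfl, fun _ => le_rfl⟩

theorem pathLe_trans {P Q R : BinPath} (h : pathLe P Q) (h' : pathLe Q R) : pathLe P R :=
  ⟨h.1.trans h'.1, fun k => (h.2 k).trans (h'.2 k)⟩

theorem pathLe_antisymm {P Q : BinPath} (h : pathLe P Q) (h' : pathLe Q P) : P = Q := by
  refine List.ext_getElem h.1 fun k hP hQ => ?_
  have e := le_antisymm (h.2 k) (h'.2 k)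
  have e' := le_antisymm (h.2 (k + 1)) (h'.2 (k + 1))
  rw [ht_succ hP, ht_succ hQ, e, List.getD_eq_getElem _ _ hP, List.getD_eq_getElem _ _ hQ] at e'
  cases hp : P[k] <;> cases hq : Q[k] <;> simp [hp, hq] at e' ⊢

theorem pathLe_maxPath (P : BinPath) : pathLe P (maxPath P.length) := by
  have hl : (maxPath P.length).length = P.length := by simp [maxPath]
  refine pathLe_of_forall_le_length hl.symm fun k => ?_
  induction k with
  | zero => simp [ht_zero]
  | succ k ih =>
    intro hk
    have e : (maxPath P.length).getD k true = true := by simp [maxPath]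
    rw [ht_succ hk, ht_succ (hl.symm ▸ hk), e]
    specialize ih (by omega)
    split_ifs <;> simp_all
    omega

theorem fill_mono {P Q : BinPath} (h : pathLe P Q) : pathLe (fill P) (fill Q) := by
  obtain ⟨hl, h⟩ := h
  refine pathLe_of_forall_le_length (by simp [length_fill, hl]) fun k hk => ?_
  rw [length_fill] at hk
  cases k with
  | zero => simp [ht_zero]
  | succ k =>
    rcases hk.lt_or_eq with hk | hk
    · rw [ht_fill_eq_min hk, ht_fill_eq_min (hl ▸ hk)]
      gcongr <;> exact h _
    · rw [ht_fill_last hk, ht_fill_last (hk.trans hl)]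
      gcongr
      exact h _

/-- The length of every chain from `P` to `1ₙ` with small
intervals is at least the degree `δ(P)`. -/
theorem statement4 (n : ℕ) (P : BinPath) (hP : P.length = n)
    (k : ℕ) (c : ℕ → BinPath)
    (h0 : c 0 = P) (hk : c k = maxPath n)
    (hchain : ∀ i < k, pathLt (c i) (c (i + 1)) ∧ pathLe (c (i + 1)) (fill (c i))) :
    degree P ≤ k := by
  have key : ∀ i ≤ k, pathLe (c i) (fill^[i] P) := by
    intro i
    induction i with
    | zero => exact fun _ => h0 ▸ pathLe_refl _
    | succ i ih =>
      intro hi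
      rw [Function.iterate_succ_apply']
      exact pathLe_trans (hchain i hi).2 (fill_mono (ih (by omega)))
  have hmax := key k le_rfl
  rw [hk] at hmax
  have hl : n = (fill^[k] P).length := by simpa [maxPath] using hmax.1
  refine Nat.sInf_le (pathLe_antisymm ?_ (hP ▸ hmax))
  rw [hP]
  exact hl ▸ pathLe_maxPath _
end
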